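/- Fix d ≥ 1. For any norm ‖·‖ on ℝ^d, the associated uncentered Hardy–Littlewood maximal operator M acting on the Lipschitz functions of (ℝ^d, ‖·‖) satisfies ‖M‖_{Op(1)} ≤ d/(d+1); that is, for every f : ℝ^d → ℝ with Lipschitz constant Lip(f) with respect to ‖·‖, Lip(Mf) ≤ (d/(d+1)) Lip(f). -/

import Mathlib

open MeasureTheory Set Filter Topology

/-- The closed ball of the norm-like function `N`, with center `c` and radius `R`. -/
def nball {d : ℕ} (N : (Fin d → ℝ) → ℝ) (c : Fin d → ℝ) (R : ℝ) : Set (Fin d → ℝ) :=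
  {y | N (y - c) ≤ R}

/-- The uncentered Hardy–Littlewood maximal function associated to the norm `N`,
with respect to `d`-dimensional Lebesgue measure. -/
noncomputable def maxFn {d : ℕ} (N : (Fin d → ℝ) → ℝ) (f : (Fin d → ℝ) → ℝ)
    (x : Fin d → ℝ) : ℝ :=
  sSup {a : ℝ | ∃ c : Fin d → ℝ, ∃ R : ℝ, 0 < R ∧ x ∈ nball N c R ∧
    a = ⨍ y in nball N c R, |f y|}

/-- The modulus of continuity of `g`, with distances measured using `N`. -/
noncomputable def modCont {d : ℕ} (N : (Fin d → ℝ) → ℝ) (g : (Fin d → ℝ) → ℝ) (δ : ℝ) : ℝ :=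
  sSup {a : ℝ | ∃ x y : Fin d → ℝ, N (x - y) ≤ δ ∧ a = |g x - g y|}

/-- `N` is a norm on `ℝ^d`. -/
structure IsNorm {d : ℕ} (N : (Fin d → ℝ) → ℝ) : Prop where
  eq_zero_iff : ∀ x, N x = 0 ↔ x = 0
  add_le : ∀ x y, N (x + y) ≤ N x + N y
  smul : ∀ (a : ℝ) (x), N (a • x) = |a| * N x

/-- `ω` is a modulus of continuity: continuous, nondecreasing, subadditive on `[0,∞)`,
vanishing at `0`, nonnegative, and not identically zero. -/
structure IsModulus (ω : ℝ → ℝ) : Prop where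
  nonneg : ∀ t, 0 ≤ t → 0 ≤ ω t
  map_zero : ω 0 = 0
  mono : MonotoneOn ω (Ici 0)
  subadd : ∀ a b, 0 ≤ a → 0 ≤ b → ω (a + b) ≤ ω a + ω b
  cont : ContinuousOn ω (Ici 0)
  nontrivial : ∃ t, 0 < t ∧ ω t ≠ 0

/-- The `Lip(ω)` seminorm of `f`: `sup_{t>0} ω(f,t)/ω(t)`. -/
noncomputable def lipNorm {d : ℕ} (N : (Fin d → ℝ) → ℝ) (ω : ℝ → ℝ)
    (f : (Fin d → ℝ) → ℝ) : ℝ :=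
  sSup {a : ℝ | ∃ t : ℝ, 0 < t ∧ a = modCont N f t / ω t}

/-- The operator norm of the uncentered maximal operator on `Lip(ω)`. -/
noncomputable def opNorm (d : ℕ) (N : (Fin d → ℝ) → ℝ) (ω : ℝ → ℝ) : ℝ :=
  sSup {a : ℝ | ∃ f : (Fin d → ℝ) → ℝ, lipNorm N ω f = 1 ∧ a = lipNorm N ω (maxFn N f)}

/-- The Hölder `α` seminorm of `f`, distances measured with `N`. -/
noncomputable def holderNorm {d : ℕ} (N : (Fin d → ℝ) → ℝ) (α : ℝ)
    (f : (Fin d → ℝ) → ℝ) : ℝ :=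
  sSup {a : ℝ | ∃ x y : Fin d → ℝ, x ≠ y ∧ a = |f x - f y| / N (x - y) ^ α}

/-- The operator norm of the uncentered maximal operator on the Hölder class `Lip_α`. -/
noncomputable def opNormHolder (d : ℕ) (N : (Fin d → ℝ) → ℝ) (α : ℝ) : ℝ :=
  sSup {a : ℝ | ∃ f : (Fin d → ℝ) → ℝ, holderNorm N α f = 1 ∧
    a = holderNorm N α (maxFn N f)}
namespace IsNorm

open scoped Pointwise

variable {d : ℕ} {N : (Fin d → ℝ) → ℝ}

lemma map_zero (hN : IsNorm N) : N 0 = 0 := (hN.eq_zero_iff 0).2 rfl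

lemma map_neg (hN : IsNorm N) (x : Fin d → ℝ) : N (-x) = N x := by
  simpa using hN.smul (-1) x

lemma map_sub_comm (hN : IsNorm N) (x y : Fin d → ℝ) : N (x - y) = N (y - x) := by
  rw [← hN.map_neg, neg_sub]

lemma nonneg (hN : IsNorm N) (x : Fin d → ℝ) : 0 ≤ N x := by
  have h := hN.add_le x (-x)
  rw [add_neg_cancel, hN.map_zero, hN.map_neg] at h
  linarith

lemma map_sub_pos (hN : IsNorm N) {x y : Fin d → ℝ} (h : x ≠ y) : 0 < N (x - y) :=
  (hN.nonneg _).lt_of_ne fun h0 => h (sub_eq_zero.1 ((hN.eq_zero_iff _).1 h0.symm))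

lemma convexOn (hN : IsNorm N) : ConvexOn ℝ univ N := by
  refine ⟨convex_univ, fun x _ y _ a b ha hb _ => (hN.add_le _ _).trans_eq ?_⟩
  rw [hN.smul, hN.smul, abs_of_nonneg ha, abs_of_nonneg hb, smul_eq_mul, smul_eq_mul]

lemma continuous (hN : IsNorm N) : Continuous N :=
  hN.convexOn.locallyLipschitz.continuous

lemma continuous_of_lipschitz (hN : IsNorm N) {g : (Fin d → ℝ) → ℝ} {L : ℝ}
    (hg : ∀ x y, |g x - g y| ≤ L * N (x - y)) : Continuous g := by
  refine continuous_iff_continuousAt.2 fun x => ?_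
  refine tendsto_iff_dist_tendsto_zero.2 <| squeeze_zero (fun _ => dist_nonneg)
    (fun y => (Real.dist_eq _ _).trans_le (hg y x)) ?_
  have h : Continuous fun y => L * N (y - x) :=
    continuous_const.mul (hN.continuous.comp (continuous_id.sub continuous_const))
  simpa [hN.map_zero] using h.tendsto x

lemma measurableSet_nball (hN : IsNorm N) (c : Fin d → ℝ) (R : ℝ) :
    MeasurableSet (nball N c R) :=
  (isClosed_le (hN.continuous.comp (continuous_id.sub continuous_const))
    continuous_const).measurableSet

lemma smul_nball_zero_one (hN : IsNorm N) {R : ℝ} (hR : 0 < R) :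
    R • nball N 0 1 = nball N 0 R := by
  ext y
  rw [mem_smul_set_iff_inv_smul_mem₀ hR.ne']
  simp only [nball, mem_ofPred_eq, sub_zero, hN.smul, abs_of_pos (inv_pos.2 hR)]
  rw [inv_mul_le_iff₀ hR, mul_one]

lemma volume_real_nball_zero (hN : IsNorm N) {R : ℝ} (hR : 0 < R) :
    volume.real (nball N 0 R) = R ^ d * volume.real (nball N 0 1) := by
  rw [← hN.smul_nball_zero_one hR, measureReal_def, Measure.addHaar_smul_of_nonneg _ hR.le,
    ENNReal.toReal_mul, ENNReal.toReal_ofReal (by positivity), measureReal_def]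
  simp

lemma volume_nball_zero_one_lt_top (hN : IsNorm N) (hd : 1 ≤ d) :
    volume (nball N 0 1) < ⊤ := by
  have : Nonempty (Fin d) := ⟨⟨0, hd⟩⟩
  have hle := measure_le_eq_lt volume hN.map_zero (fun {x} => hN.map_neg x)
    (fun {x y} => hN.add_le x y) (fun {x} => (hN.eq_zero_iff x).1)
    (fun {r x} => (hN.smul r x).le) 1
  have hlt := measure_lt_one_eq_integral_div_gamma volume hN.map_zero (fun {x} => hN.map_neg x)
    (fun {x y} => hN.add_le x y) (fun {x} => (hN.eq_zero_iff x).1)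
    (fun {r x} => (hN.smul r x).le) one_pos
  have h : nball N 0 1 = {x | N x ≤ 1} := by simp [nball]
  rw [h, hle, hlt]
  exact ENNReal.ofReal_lt_top

lemma volume_real_nball_zero_one_pos (hN : IsNorm N) (hd : 1 ≤ d) :
    0 < volume.real (nball N 0 1) := by
  refine ENNReal.toReal_pos (ne_of_gt ?_) (hN.volume_nball_zero_one_lt_top hd).ne
  have ho : IsOpen {x | N x < 1} := isOpen_lt hN.continuous continuous_const
  refine (ho.measure_pos volume ⟨0, by simp [hN.map_zero]⟩).trans_le (measure_mono fun x hx => ?_)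
  simpa [nball] using le_of_lt hx

lemma setIntegral_nball (hN : IsNorm N) (g : (Fin d → ℝ) → ℝ) (c : Fin d → ℝ) {R : ℝ}
    (hR : 0 < R) :
    ∫ y in nball N c R, g y = R ^ d * ∫ u in nball N 0 1, g (c + R • u) := by
  rw [Measure.setIntegral_comp_smul_of_pos volume (fun y => g (c + y)) _ hR,
    hN.smul_nball_zero_one hR, Module.finrank_fin_fun, smul_eq_mul,
    mul_inv_cancel_left₀ (by positivity),
    ← integral_indicator (hN.measurableSet_nball _ _),
    ← integral_indicator (hN.measurableSet_nball _ _),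
    ← integral_add_left_eq_self _ c]
  congr 1 with y
  simp [indicator, nball]

lemma average_nball (hN : IsNorm N) (g : (Fin d → ℝ) → ℝ) (c : Fin d → ℝ) {R : ℝ}
    (hR : 0 < R) :
    ⨍ y in nball N c R, g y = ⨍ u in nball N 0 1, g (c + R • u) := by
  have hv := hN.setIntegral_nball (fun _ => 1) c hR
  simp only [setIntegral_const, smul_eq_mul, mul_one] at hv
  rw [setAverage_eq, setAverage_eq, hN.setIntegral_nball g c hR, hv, smul_eq_mul, smul_eq_mul,
    mul_inv]
  have : R ^ d ≠ 0 := by positivity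
  field_simp

lemma integrableOn_nball_zero_one (hN : IsNorm N) (hd : 1 ≤ d) {g : (Fin d → ℝ) → ℝ} {L : ℝ}
    (hg : ∀ x y, |g x - g y| ≤ L * N (x - y)) : IntegrableOn g (nball N 0 1) := by
  refine IntegrableOn.of_bound (hN.volume_nball_zero_one_lt_top hd)
    (hN.continuous_of_lipschitz hg).aestronglyMeasurable (|L| + |g 0|) ?_
  refine (ae_restrict_mem (hN.measurableSet_nball 0 1)).mono fun x hx => ?_
  have hx : N (x - 0) ≤ 1 := hx
  have h1 := (hg x 0).trans ((mul_le_mul_of_nonneg_right (le_abs_self L) (hN.nonneg _)).trans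
    (mul_le_of_le_one_right (abs_nonneg L) hx))
  have h2 := abs_sub_abs_le_abs_sub (g x) (g 0)
  rw [Real.norm_eq_abs]
  linarith

lemma abs_sub_le (hN : IsNorm N) (x y : Fin d → ℝ) : |N x - N y| ≤ 1 * N (x - y) := by
  have h1 := hN.add_le (x - y) y
  have h2 := hN.add_le (y - x) x
  rw [hN.map_sub_comm y x] at h2
  simp only [sub_add_cancel] at h1 h2
  rw [abs_le]
  constructor <;> linarith

lemma setIntegral_self (hN : IsNorm N) (hd : 1 ≤ d) :
    ∫ u in nball N 0 1, N u = (d : ℝ) / (d + 1) * volume.real (nball N 0 1) := by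
  have hfin := hN.volume_nball_zero_one_lt_top hd
  have hlevel : ∀ t : ℝ, 0 < t → t ≤ 1 →
      (volume.restrict (nball N 0 1)).real {u | t < N u}
        = (1 - t ^ d) * volume.real (nball N 0 1) := by
    intro t ht ht1
    have hsub : nball N 0 t ⊆ nball N 0 1 := fun u hu => le_trans hu ht1
    have hset : {u | t < N u} ∩ nball N 0 1 = nball N 0 1 \ nball N 0 t := by
      ext u
      simp [nball, and_comm]
    rw [measureReal_restrict_apply (measurableSet_lt measurable_const hN.continuous.measurable),
      hset, measureReal_sdiff hsub (hN.measurableSet_nball 0 t) hfin.ne, hN.volume_real_nball_zero ht]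
    ring
  rw [Integrable.integral_eq_integral_meas_lt (hN.integrableOn_nball_zero_one hd hN.abs_sub_le)
    (.of_forall hN.nonneg), setIntegral_eq_of_subset_of_forall_sdiff_eq_zero
    measurableSet_Ioi (Ioc_subset_Ioi_self : Ioc (0 : ℝ) 1 ⊆ Ioi 0),
    setIntegral_congr_fun measurableSet_Ioc fun t ht => hlevel t ht.1 ht.2,
    ← intervalIntegral.integral_of_le zero_le_one, intervalIntegral.integral_mul_const,
    intervalIntegral.integral_sub (by simp) (by simp), integral_pow]
  · have : (d : ℝ) + 1 ≠ 0 := by positivity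
    simp
    left
    field_simp
    ring
  · rintro t ⟨ht, ht'⟩
    have ht1 : 1 < t := by simpa [mem_Ioi.1 ht] using ht'
    rw [measureReal_restrict_apply (measurableSet_lt measurable_const hN.continuous.measurable)]
    convert measureReal_empty
    refine eq_empty_of_forall_notMem fun u hu => ?_
    have h1 : t < N u := hu.1
    have h2 : N u ≤ 1 := by simpa [nball] using hu.2
    linarith

lemma average_nball_le (hN : IsNorm N) (hd : 1 ≤ d) {g : (Fin d → ℝ) → ℝ} {L : ℝ}
    (hg : ∀ x y, |g x - g y| ≤ L * N (x - y)) (c : Fin d → ℝ) {R R' : ℝ} (hR : 0 < R)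
    (hRR' : R ≤ R') :
    ⨍ y in nball N c R, g y ≤ (⨍ y in nball N c R', g y) + (d : ℝ) / (d + 1) * (L * (R' - R)) := by
  have hV := hN.volume_real_nball_zero_one_pos hd
  have hint : ∀ r : ℝ, IntegrableOn (fun u => g (c + r • u)) (nball N 0 1) := fun r =>
    hN.integrableOn_nball_zero_one hd (L := L * |r|) fun x y => by
      have h := hg (c + r • x) (c + r • y)
      rwa [add_sub_add_left_eq_sub, ← smul_sub, hN.smul, ← mul_assoc] at h
  have hNint := hN.integrableOn_nball_zero_one hd hN.abs_sub_le
  have hle : ∫ u in nball N 0 1, g (c + R • u)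
      ≤ ∫ u in nball N 0 1, (g (c + R' • u) + L * (R' - R) * N u) := by
    refine integral_mono (hint R) ((hint R').add (hNint.const_mul _)) fun u => ?_
    have h := (le_abs_self _).trans (hg (c + R • u) (c + R' • u))
    rw [add_sub_add_left_eq_sub, ← sub_smul, hN.smul, abs_sub_comm,
      abs_of_nonneg (sub_nonneg.2 hRR')] at h
    change g (c + R • u) ≤ g (c + R' • u) + L * (R' - R) * N u
    linarith
  rw [integral_add (hint R') (hNint.const_mul _), integral_const_mul, hN.setIntegral_self hd] at hle
  rw [hN.average_nball g c hR, hN.average_nball g c (hR.trans_le hRR'), setAverage_eq,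
    setAverage_eq, smul_eq_mul, smul_eq_mul, inv_mul_le_iff₀ hV, mul_add,
    mul_inv_cancel_left₀ hV.ne']
  linarith

lemma exists_average_nball_le (hN : IsNorm N) (hd : 1 ≤ d) {g : (Fin d → ℝ) → ℝ} {L : ℝ}
    (hL : 0 ≤ L) (hg : ∀ x y, |g x - g y| ≤ L * N (x - y)) {x c : Fin d → ℝ} {R : ℝ}
    (hR : 0 < R) (hx : x ∈ nball N c R) (y : Fin d → ℝ) :
    ∃ R', 0 < R' ∧ y ∈ nball N c R' ∧ ⨍ z in nball N c R, g z
      ≤ (⨍ z in nball N c R', g z) + (d : ℝ) / (d + 1) * L * N (x - y) := by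
  have hx : N (x - c) ≤ R := hx
  refine ⟨max R (N (y - c)), lt_max_of_lt_left hR, le_max_right R (N (y - c)),
    (hN.average_nball_le hd hg c hR (le_max_left R (N (y - c)))).trans ?_⟩
  have htri := hN.add_le (y - x) (x - c)
  rw [sub_add_sub_cancel, hN.map_sub_comm y x] at htri
  have hmax : max R (N (y - c)) - R ≤ N (x - y) := by
    rw [sub_le_iff_le_add]
    exact max_le (by linarith [hN.nonneg (x - y)]) (by linarith)
  rw [mul_assoc]
  gcongr

lemma abs_maxFn_sub_le (hN : IsNorm N) (hd : 1 ≤ d) {f : (Fin d → ℝ) → ℝ} {L : ℝ}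
    (hL : 0 ≤ L) (hf : ∀ x y, |f x - f y| ≤ L * N (x - y)) (x y : Fin d → ℝ) :
    |maxFn N f x - maxFn N f y| ≤ (d : ℝ) / (d + 1) * L * N (x - y) := by
  have hg : ∀ x y, abs (|f x| - |f y|) ≤ L * N (x - y) := fun x y =>
    (abs_abs_sub_abs_le _ _).trans (hf x y)
  let A : (Fin d → ℝ) → Set ℝ := fun x => {a | ∃ c : Fin d → ℝ, ∃ R : ℝ, 0 < R ∧
    x ∈ nball N c R ∧ a = ⨍ y in nball N c R, |f y|}
  have hne : ∀ x, (A x).Nonempty := fun x =>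
    ⟨_, x, 1, one_pos, by simp [nball, hN.map_zero], rfl⟩
  have hA : ∀ x y, ∀ a ∈ A x, ∃ b ∈ A y, a ≤ b + (d : ℝ) / (d + 1) * L * N (x - y) := by
    rintro x y _ ⟨c, R, hR, hx, rfl⟩
    obtain ⟨R', hR', hy, h⟩ := hN.exists_average_nball_le hd hL hg hR hx y
    exact ⟨_, ⟨c, R', hR', hy, rfl⟩, h⟩
  have hbdd : ∀ x y, BddAbove (A y) → BddAbove (A x) := by
    rintro x y ⟨M, hM⟩
    refine ⟨M + (d : ℝ) / (d + 1) * L * N (x - y), fun a ha => ?_⟩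
    obtain ⟨b, hb, hab⟩ := hA x y a ha
    linarith [hM hb]
  have hsup : ∀ x y, BddAbove (A y) →
      sSup (A x) ≤ sSup (A y) + (d : ℝ) / (d + 1) * L * N (x - y) := by
    refine fun x y hy => csSup_le (hne x) fun a ha => ?_
    obtain ⟨b, hb, hab⟩ := hA x y a ha
    linarith [le_csSup hy hb]
  change |sSup (A x) - sSup (A y)| ≤ _
  by_cases hy : BddAbove (A y)
  · have h1 := hsup x y hy
    have h2 := hsup y x (hbdd x y hy)
    rw [hN.map_sub_comm y x] at h2
    rw [abs_le]
    constructor <;> linarith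
  · rw [Real.sSup_of_not_bddAbove hy, Real.sSup_of_not_bddAbove (mt (hbdd y x) hy), sub_zero,
      abs_zero]
    have := hN.nonneg (x - y)
    positivity

lemma holderNorm_nonneg (hN : IsNorm N) (α : ℝ) (f : (Fin d → ℝ) → ℝ) :
    0 ≤ holderNorm N α f := by
  refine Real.sSup_nonneg ?_
  rintro _ ⟨x, y, -, rfl⟩
  have := hN.nonneg (x - y)
  positivity

lemma holderNorm_one_le (hN : IsNorm N) {g : (Fin d → ℝ) → ℝ} {L : ℝ} (hL : 0 ≤ L)
    (hg : ∀ x y, |g x - g y| ≤ L * N (x - y)) : holderNorm N 1 g ≤ L := by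
  refine Real.sSup_le ?_ hL
  rintro _ ⟨x, y, hxy, rfl⟩
  rw [Real.rpow_one]
  exact (div_le_iff₀ (hN.map_sub_pos hxy)).2 (hg x y)

lemma abs_sub_le_holderNorm_mul (hN : IsNorm N) {f : (Fin d → ℝ) → ℝ}
    (hf : BddAbove {a : ℝ | ∃ x y : Fin d → ℝ, x ≠ y ∧ a = |f x - f y| / N (x - y) ^ (1 : ℝ)})
    (x y : Fin d → ℝ) : |f x - f y| ≤ holderNorm N 1 f * N (x - y) := by
  obtain rfl | hxy := eq_or_ne x y
  · simp [hN.map_zero]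
  · rw [← div_le_iff₀ (hN.map_sub_pos hxy)]
    refine le_csSup hf ⟨x, y, hxy, ?_⟩
    rw [Real.rpow_one]

lemma holderNorm_maxFn_le (hN : IsNorm N) (hd : 1 ≤ d) {f : (Fin d → ℝ) → ℝ}
    (hf : BddAbove {a : ℝ | ∃ x y : Fin d → ℝ, x ≠ y ∧ a = |f x - f y| / N (x - y) ^ (1 : ℝ)}) :
    holderNorm N 1 (maxFn N f) ≤ (d : ℝ) / (d + 1) * holderNorm N 1 f := by
  have h0 := hN.holderNorm_nonneg 1 f
  exact hN.holderNorm_one_le (by positivity)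
    (hN.abs_maxFn_sub_le hd h0 (hN.abs_sub_le_holderNorm_mul hf))

end IsNorm

/-- For any norm on `ℝ^d`, the uncentered maximal operator acting on Lipschitz functions
satisfies `‖M‖_{Op(1)} ≤ d/(d+1)`; that is, `Lip(Mf) ≤ (d/(d+1)) Lip(f)` for every
Lipschitz `f`. -/
theorem stmt4 (d : ℕ) (hd : 1 ≤ d) (N : (Fin d → ℝ) → ℝ) (hN : IsNorm N) :
    opNormHolder d N 1 ≤ (d : ℝ) / (d + 1) ∧
    ∀ f : (Fin d → ℝ) → ℝ, (∃ C : ℝ, ∀ x y, |f x - f y| ≤ C * N (x - y)) →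
      holderNorm N 1 (maxFn N f) ≤ ((d : ℝ) / (d + 1)) * holderNorm N 1 f := by
  refine ⟨Real.sSup_le ?_ (by positivity), ?_⟩
  · rintro _ ⟨f, hf, rfl⟩
    refine (hN.holderNorm_maxFn_le hd ?_).trans_eq (by rw [hf, mul_one])
    by_contra h
    rw [holderNorm, Real.sSup_of_not_bddAbove h] at hf
    exact zero_ne_one hf
  · rintro f ⟨C, hC⟩
    refine hN.holderNorm_maxFn_le hd ⟨C, ?_⟩
    rintro _ ⟨x, y, hxy, rfl⟩
    rw [Real.rpow_one]
    exact (div_le_iff₀ (hN.map_sub_pos hxy)).2 (hC x y)
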